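/- For compositions γ ≤_ℓ α of n, the row-strict immaculate Kostka number satisfies K*_{α,γ} = ∑_{β ≽ γ} L*_{α,β} = ∑_{β ≽ γ} L_{α,βᶜ}, where the sums are over coarsenings β of γ. -/

import Mathlib

open scoped Classical

/-- The cells of the diagram of a composition shape `l` (row `i`, column `j`, both
`0`-indexed; row `0` is the bottom row). -/
def cellsOf (l : List ℕ) : Finset (ℕ × ℕ) :=
  (Finset.range l.length ×ˢ Finset.range (l.foldr max 0)).filter fun c => c.2 < l.getD c.1 0

/-- An immaculate tableau of shape `l`: entries are positive integers, the leftmost column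
strictly increases bottom to top, rows weakly increase left to right (the filling is `0`
outside the diagram). -/
def IsImm (l : List ℕ) (T : ℕ × ℕ → ℕ) : Prop :=
  (∀ c ∈ cellsOf l, 1 ≤ T c) ∧ (∀ c ∉ cellsOf l, T c = 0) ∧
  (∀ i i' : ℕ, i < i' → (i, 0) ∈ cellsOf l → (i', 0) ∈ cellsOf l → T (i, 0) < T (i', 0)) ∧
  (∀ i j : ℕ, (i, j + 1) ∈ cellsOf l → T (i, j) ≤ T (i, j + 1))

/-- A row-strict immaculate tableau of shape `l`: entries are positive integers, the
leftmost column weakly increases bottom to top, rows strictly increase left to right. -/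
def IsRS (l : List ℕ) (T : ℕ × ℕ → ℕ) : Prop :=
  (∀ c ∈ cellsOf l, 1 ≤ T c) ∧ (∀ c ∉ cellsOf l, T c = 0) ∧
  (∀ i i' : ℕ, i < i' → (i, 0) ∈ cellsOf l → (i', 0) ∈ cellsOf l → T (i, 0) ≤ T (i', 0)) ∧
  (∀ i j : ℕ, (i, j + 1) ∈ cellsOf l → T (i, j) < T (i, j + 1))

/-- The content of a filling, as the exponent vector of its content monomial `x^T`
(the variable `x_k` is recorded for an entry `k`). -/
noncomputable def contentOf (l : List ℕ) (T : ℕ × ℕ → ℕ) : ℕ →₀ ℕ :=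
  ∑ c ∈ cellsOf l, Finsupp.single (T c) 1

/-- The dual immaculate function `𝔖*_α = ∑_T x^T`, the generating function of
immaculate tableaux of shape `α`. -/
noncomputable def DIfn (l : List ℕ) : MvPowerSeries ℕ ℚ :=
  fun d => (Nat.card {T : ℕ × ℕ → ℕ // IsImm l T ∧ contentOf l T = d} : ℚ)

/-- The row-strict dual immaculate function `ℛ𝔖*_α = ∑_U x^U`, the generating function
of row-strict immaculate tableaux of shape `α`. -/
noncomputable def RSfn (l : List ℕ) : MvPowerSeries ℕ ℚ :=
  fun d => (Nat.card {T : ℕ × ℕ → ℕ // IsRS l T ∧ contentOf l T = d} : ℚ)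

/-- The content of a standard filling: each of `1, …, n` exactly once. -/
noncomputable def stdContent (n : ℕ) : ℕ →₀ ℕ :=
  ∑ k ∈ Finset.range n, Finsupp.single (k + 1) 1

/-- The composition of `n` corresponding to a subset of `{1,…,n-1}`. -/
def ofFinsetC (n : ℕ) (S : Finset (Fin (n - 1))) : Composition n :=
  (compositionEquiv n).symm ((compositionAsSetEquiv n).symm S)

/-- The row-strict descent set `Des_{ℛ𝔖*}(T) = {i : i+1 lies weakly below i in T}` of a
standard tableau `T` of shape `α ⊨ n`, encoded in `Fin (n-1)` (`i` representing `i+1`). -/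
def DesRS (n : ℕ) (l : List ℕ) (T : ℕ × ℕ → ℕ) : Finset (Fin (n - 1)) :=
  Finset.univ.filter fun i =>
    ∃ c ∈ cellsOf l, ∃ c' ∈ cellsOf l, T c = i.val + 1 ∧ T c' = i.val + 2 ∧ c'.1 ≤ c.1

/-- The descent set `Des_{𝔖*}(T) = {i : i+1 lies strictly above i in T}`. -/
def DesDI (n : ℕ) (l : List ℕ) (T : ℕ × ℕ → ℕ) : Finset (Fin (n - 1)) :=
  Finset.univ.filter fun i =>
    ∃ c ∈ cellsOf l, ∃ c' ∈ cellsOf l, T c = i.val + 1 ∧ T c' = i.val + 2 ∧ c.1 < c'.1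

/-- `comp(Des_{ℛ𝔖*}(T))` for a standard tableau of shape `α ⊨ n`. -/
def descCompRS {n : ℕ} (α : Composition n) (T : ℕ × ℕ → ℕ) : Composition n :=
  ofFinsetC n (DesRS n α.blocks T)

/-- `comp(Des_{𝔖*}(T))` for a standard tableau of shape `α ⊨ n`. -/
def descCompDI {n : ℕ} (α : Composition n) (T : ℕ × ℕ → ℕ) : Composition n :=
  ofFinsetC n (DesDI n α.blocks T)

/-- Encoding of the subset of `{1,…,n-1}` corresponding to a composition. -/
def toFinsetC {n : ℕ} (α : Composition n) : Finset (Fin (n - 1)) :=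
  compositionAsSetEquiv n (compositionEquiv n α)

/-- The complement composition `αᶜ = comp(set(α)ᶜ)`. -/
def complC {n : ℕ} (α : Composition n) : Composition n :=
  ofFinsetC n (toFinsetC α)ᶜ

/-- `γ` refines `β` (so `β` is a coarsening of `γ`, `β ≽ γ`). -/
def Refines {n : ℕ} (γ β : Composition n) : Prop :=
  ∃ L : List (List ℕ), L.flatten = γ.blocks ∧ L.map List.sum = β.blocks

/-- The exponent vector of the monomial `x₁^{γ₁} x₂^{γ₂} ⋯`, i.e. content `γ`. -/
noncomputable def compContent {n : ℕ} (γ : Composition n) : ℕ →₀ ℕ :=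
  ∑ j : Fin γ.length, Finsupp.single (j.val + 1) (γ.blocks.get j)

/-- `K*_{α,γ}`: the number of row-strict immaculate tableaux of shape `α` and content `γ`. -/
noncomputable def Kstar {n : ℕ} (α γ : Composition n) : ℕ :=
  Nat.card {T : ℕ × ℕ → ℕ // IsRS α.blocks T ∧ contentOf α.blocks T = compContent γ}

/-- `L_{α,β}`: the number of standard immaculate tableaux of shape `α` with
`comp(Des_{𝔖*}(T)) = β`. -/
noncomputable def Lnum {n : ℕ} (α β : Composition n) : ℕ :=
  Nat.card {T : ℕ × ℕ → ℕ // IsImm α.blocks T ∧ contentOf α.blocks T = stdContent n ∧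
    descCompDI α T = β}

/-- `L*_{α,β}`: the number of standard immaculate tableaux of shape `α` with
`comp(Des_{ℛ𝔖*}(T)) = β`. -/
noncomputable def Lstar {n : ℕ} (α β : Composition n) : ℕ :=
  Nat.card {T : ℕ × ℕ → ℕ // IsImm α.blocks T ∧ contentOf α.blocks T = stdContent n ∧
    descCompRS α T = β}

/-- Lexicographic comparison of compositions. -/
def lexLE {n : ℕ} (γ α : Composition n) : Prop :=
  γ.blocks = α.blocks ∨ List.Lex (· < ·) γ.blocks α.blocks

theorem contentOf_apply (l : List ℕ) (T : ℕ × ℕ → ℕ) (v : ℕ) :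
    contentOf l T v = ((cellsOf l).filter fun c => T c = v).card := by
  rw [Finset.card_filter, contentOf, Finsupp.finsetSum_apply]
  exact Finset.sum_congr rfl fun c _ => Finsupp.single_apply

theorem card_entries_le_eq_sum_contentOf (l : List ℕ) (T : ℕ × ℕ → ℕ) (m : ℕ) :
    ((cellsOf l).filter fun c => T c ≤ m).card = ∑ v ∈ Finset.range (m + 1), contentOf l T v := by
  rw [Finset.card_eq_sum_card_fiberwise (f := T) (t := Finset.range (m + 1))]
  · refine Finset.sum_congr rfl fun v hv => ?_
    rw [contentOf_apply, Finset.filter_filter]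
    congr 1
    ext c
    simp only [Finset.mem_filter, Finset.mem_range] at hv ⊢
    grind
  · intro c hc
    simp only [Finset.coe_filter, Set.mem_ofPred_eq, Finset.coe_range, Set.mem_Iio] at hc ⊢
    omega

/-- A content is determined by its cumulative sums. -/
theorem contentOf_eq_iff_card_entries_le (l : List ℕ) (T : ℕ × ℕ → ℕ) (d : ℕ →₀ ℕ) :
    contentOf l T = d ↔ ∀ m, ((cellsOf l).filter fun c => T c ≤ m).card =
      ∑ v ∈ Finset.range (m + 1), d v := by
  simp only [card_entries_le_eq_sum_contentOf]
  refine ⟨fun h m => by rw [h], fun h => Finsupp.ext fun v => ?_⟩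
  cases v with
  | zero => simpa using h 0
  | succ v =>
    have h1 := h (v + 1)
    rw [Finset.sum_range_succ, Finset.sum_range_succ _ (v + 1), h v] at h1
    omega

theorem compContent_zero {n : ℕ} (γ : Composition n) : compContent γ 0 = 0 := by
  simp [compContent, Finsupp.finsetSum_apply]

theorem compContent_succ {n : ℕ} (γ : Composition n) (v : ℕ) :
    compContent γ (v + 1) = γ.blocks.getD v 0 := by
  simp only [compContent, Finsupp.finsetSum_apply, Finsupp.single_apply, Nat.add_right_cancel_iff]
  by_cases hv : v < γ.length
  · rw [Finset.sum_eq_single (⟨v, hv⟩ : Fin γ.length)]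
    · simp [hv]
    · intro b _ hb
      exact if_neg fun h => hb (Fin.ext h)
    · simp
  · rw [Finset.sum_eq_zero fun j _ => if_neg (by have := j.isLt; omega),
      List.getD_eq_default _ _ (by simpa using hv)]

theorem sum_range_compContent {n : ℕ} (γ : Composition n) (m : ℕ) :
    ∑ v ∈ Finset.range (m + 1), compContent γ v = γ.sizeUpTo m := by
  induction m with
  | zero => simp [compContent_zero]
  | succ m ih =>
    rw [Finset.sum_range_succ, ih, compContent_succ]
    by_cases hm : m < γ.length
    · rw [γ.sizeUpTo_succ hm, List.getD_eq_getElem _ _ hm]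
    · rw [γ.sizeUpTo_ofLength_le m (by omega), γ.sizeUpTo_ofLength_le (m + 1) (by omega),
        List.getD_eq_default _ _ (by simpa using hm), Nat.add_zero]

theorem stdContent_apply (n v : ℕ) : stdContent n v = if 1 ≤ v ∧ v ≤ n then 1 else 0 := by
  simp only [stdContent, Finsupp.finsetSum_apply, Finsupp.single_apply]
  split_ifs with h
  · rw [Finset.sum_eq_single (v - 1)]
    · exact if_pos (by omega)
    · intro b _ hb
      exact if_neg (by omega)
    · intro hb
      exact absurd (Finset.mem_range.2 (by omega)) hb
  · refine Finset.sum_eq_zero fun b hb => if_neg ?_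
    have := Finset.mem_range.1 hb
    omega

theorem sum_range_stdContent (n m : ℕ) :
    ∑ v ∈ Finset.range (m + 1), stdContent n v = min m n := by
  induction m with
  | zero => simp [stdContent_apply]
  | succ m ih =>
    rw [Finset.sum_range_succ, ih, stdContent_apply]
    split_ifs <;> omega

section Standard

variable {n : ℕ} {l : List ℕ} {T : ℕ × ℕ → ℕ}

theorem card_entries_eq_of_std (v : ℕ) (hT : contentOf l T = stdContent n) :
    ((cellsOf l).filter fun c => T c = v).card = if 1 ≤ v ∧ v ≤ n then 1 else 0 := by
  rw [← contentOf_apply, hT, stdContent_apply]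

theorem entry_bounds_of_std (hT : contentOf l T = stdContent n) {c : ℕ × ℕ}
    (hc : c ∈ cellsOf l) : 1 ≤ T c ∧ T c ≤ n := by
  by_contra h
  have h1 := card_entries_eq_of_std (T c) hT
  rw [if_neg h, Finset.card_eq_zero] at h1
  exact Finset.notMem_empty c (h1 ▸ Finset.mem_filter.2 ⟨hc, rfl⟩)

theorem exists_entry_of_std (hT : contentOf l T = stdContent n) {v : ℕ} (h1 : 1 ≤ v)
    (hn : v ≤ n) : ∃ c ∈ cellsOf l, T c = v := by
  have h := card_entries_eq_of_std v hT
  rw [if_pos ⟨h1, hn⟩] at h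
  obtain ⟨c, hc⟩ := Finset.card_pos.1 (h ▸ Nat.one_pos)
  exact ⟨c, (Finset.mem_filter.1 hc).1, (Finset.mem_filter.1 hc).2⟩

theorem entry_injOn_of_std (hT : contentOf l T = stdContent n) {c c' : ℕ × ℕ}
    (hc : c ∈ cellsOf l) (hc' : c' ∈ cellsOf l) (h : T c = T c') : c = c' := by
  have h1 := card_entries_eq_of_std (T c') hT
  refine Finset.card_le_one.1 (h1.trans_le ?_) c (Finset.mem_filter.2 ⟨hc, h⟩) c'
    (Finset.mem_filter.2 ⟨hc', rfl⟩)
  split_ifs <;> omega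

theorem card_entries_le_of_std (hT : contentOf l T = stdContent n) (m : ℕ) :
    ((cellsOf l).filter fun c => T c ≤ m).card = min m n := by
  rw [card_entries_le_eq_sum_contentOf, hT, sum_range_stdContent]

/-- An injective filling of `n` cells with entries in `{1, …, n}` is standard. -/
theorem contentOf_eq_stdContent_of_injOn (hcard : (cellsOf l).card = n)
    (hinj : Set.InjOn T (cellsOf l)) (hmem : ∀ c ∈ cellsOf l, 1 ≤ T c ∧ T c ≤ n) :
    contentOf l T = stdContent n := by
  have himg : (cellsOf l).image T = Finset.Icc 1 n := by
    refine Finset.eq_of_subset_of_card_le (fun v hv => ?_) ?_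
    · obtain ⟨c, hc, rfl⟩ := Finset.mem_image.1 hv
      exact Finset.mem_Icc.2 (hmem c hc)
    · rw [Finset.card_image_of_injOn hinj, hcard, Nat.card_Icc]
      omega
  ext v
  rw [contentOf_apply, stdContent_apply]
  split_ifs with h
  · obtain ⟨c, hc, rfl⟩ := Finset.mem_image.1 (himg ▸ Finset.mem_Icc.2 h)
    rw [Finset.card_eq_one]
    refine ⟨c, Finset.ext fun c' => ?_⟩
    simp only [Finset.mem_filter, Finset.mem_singleton]
    exact ⟨fun h' => hinj h'.1 hc h'.2, fun h' => by simp [h', hc]⟩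
  · rw [Finset.card_eq_zero, Finset.filter_eq_empty_iff]
    exact fun c hc h' => h (h' ▸ hmem c hc)

end Standard

/-- The index of the block of `γ` containing `x`, counted from `1`. -/
noncomputable def blockOf {n : ℕ} (γ : Composition n) (x : ℕ) : ℕ :=
  sInf {m | x ≤ γ.sizeUpTo m}

section BlockOf

variable {n : ℕ} (γ : Composition n)

theorem blockOf_le_iff {x : ℕ} (hx : x ≤ n) (m : ℕ) : blockOf γ x ≤ m ↔ x ≤ γ.sizeUpTo m := by
  have hne : {m | x ≤ γ.sizeUpTo m}.Nonempty := ⟨γ.length, by simpa using hx⟩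
  refine ⟨fun h => ?_, fun h => Nat.sInf_le h⟩
  exact (Nat.sInf_mem hne : x ≤ γ.sizeUpTo (blockOf γ x)).trans (γ.monotone_sizeUpTo h)

theorem blockOf_zero : blockOf γ 0 = 0 :=
  Nat.le_zero.1 ((blockOf_le_iff γ n.zero_le 0).2 (Nat.zero_le _))

theorem one_le_blockOf {x : ℕ} (h1 : 1 ≤ x) (hx : x ≤ n) : 1 ≤ blockOf γ x := by
  by_contra h
  have := (blockOf_le_iff γ hx 0).1 (by omega)
  rw [γ.sizeUpTo_zero] at this
  omega

theorem blockOf_mono {x y : ℕ} (hxy : x ≤ y) (hy : y ≤ n) : blockOf γ x ≤ blockOf γ y :=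
  (blockOf_le_iff γ (hxy.trans hy) _).2 (hxy.trans ((blockOf_le_iff γ hy _).1 le_rfl))

/-- Consecutive integers lie in different blocks exactly at the partial sums of `γ`. -/
theorem blockOf_lt_succ_iff {x : ℕ} (hx : x + 1 ≤ n) :
    blockOf γ x < blockOf γ (x + 1) ↔ ∃ k, γ.sizeUpTo k = x := by
  constructor
  · intro h
    refine ⟨blockOf γ x, le_antisymm ?_ ((blockOf_le_iff γ (by omega) _).1 le_rfl)⟩
    have := mt (blockOf_le_iff γ hx (blockOf γ x)).2 (by omega)
    omega
  · rintro ⟨k, hk⟩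
    have h1 := (blockOf_le_iff γ (show x ≤ n by omega) k).2 hk.ge
    have h2 := mt (blockOf_le_iff γ hx k).1 (by omega)
    omega

end BlockOf

theorem mem_toFinsetC {n : ℕ} (γ : Composition n) (i : Fin (n - 1)) :
    i ∈ toFinsetC γ ↔ ∃ k, γ.sizeUpTo k = i.val + 1 := by
  have hdef : i ∈ toFinsetC γ ↔
      (⟨1 + i.val, by have := i.isLt; omega⟩ : Fin (n + 1)) ∈ γ.boundaries := by
    simp only [toFinsetC, compositionAsSetEquiv, compositionEquiv, Equiv.coe_fn_mk,
      Set.mem_toFinset]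
    exact Iff.rfl
  rw [hdef]
  simp only [Composition.boundaries, Finset.mem_map, Finset.mem_univ, true_and,
    Composition.boundary, RelEmbedding.coe_toEmbedding, OrderEmbedding.coe_ofStrictMono,
    Fin.mk.injEq]
  constructor
  · rintro ⟨k, hk⟩
    exact ⟨k, by omega⟩
  · rintro ⟨k, hk⟩
    have hkl : k < γ.length + 1 := by
      by_contra h
      have := γ.sizeUpTo_ofLength_le k (by omega)
      have := i.isLt
      omega
    exact ⟨⟨k, hkl⟩, by simp only; omega⟩

theorem toFinsetC_ofFinsetC {n : ℕ} (S : Finset (Fin (n - 1))) :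
    toFinsetC (ofFinsetC n S) = S := by
  simp [toFinsetC, ofFinsetC]

theorem ofFinsetC_eq_iff {n : ℕ} (S : Finset (Fin (n - 1))) (β : Composition n) :
    ofFinsetC n S = β ↔ S = toFinsetC β := by
  rw [ofFinsetC, toFinsetC, Equiv.symm_apply_eq, Equiv.symm_apply_eq]

/-- A list whose partial sums include those of `b` splits into consecutive pieces with sums `b`. -/
theorem exists_flatten_eq_map_sum_eq (b g : List ℕ) (hpos : ∀ x ∈ g, 0 < x)
    (hsum : g.sum = b.sum) (h : ∀ k, ∃ m, (b.take k).sum = (g.take m).sum) :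
    ∃ L : List (List ℕ), L.flatten = g ∧ L.map List.sum = b := by
  induction b generalizing g with
  | nil =>
    refine ⟨[], ?_, rfl⟩
    cases g with
    | nil => rfl
    | cons x g =>
      have := hpos x (by simp)
      simp at hsum
      omega
  | cons x b ih =>
    obtain ⟨m, hm⟩ := h 1
    simp only [List.take_succ_cons, List.take_zero, List.sum_cons, List.sum_nil,
      Nat.add_zero] at hm
    have hsplit := List.sum_take_add_sum_drop g m
    rw [List.sum_cons] at hsum
    obtain ⟨L, hL, hL'⟩ := ih (g.drop m) (fun y hy => hpos y (List.mem_of_mem_drop hy))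
      (by omega) (fun k => by
        obtain ⟨m', hm'⟩ := h (k + 1)
        rw [List.take_succ_cons, List.sum_cons] at hm'
        rcases le_total m m' with hle | hle
        · refine ⟨m' - m, ?_⟩
          obtain ⟨r, rfl⟩ := Nat.exists_eq_add_of_le hle
          rw [List.take_add, List.sum_append] at hm'
          rw [Nat.add_sub_cancel_left]
          omega
        · refine ⟨0, ?_⟩
          have := List.monotone_sum_take g hle
          simp only [List.take_zero, List.sum_nil] at this ⊢
          omega)
    exact ⟨g.take m :: L, by simp [hL], by simp [hL', hm]⟩

theorem refines_iff {n : ℕ} (γ β : Composition n) :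
    Refines γ β ↔ toFinsetC β ⊆ toFinsetC γ := by
  constructor
  · rintro ⟨L, hL, hL'⟩ i hi
    rw [mem_toFinsetC] at hi ⊢
    obtain ⟨k, hk⟩ := hi
    refine ⟨(L.take k).flatten.length, ?_⟩
    rw [← hk, Composition.sizeUpTo, Composition.sizeUpTo, ← hL, ← hL', ← List.map_take,
      ← List.sum_flatten]
    congr 1
    conv_lhs => rw [← List.take_append_drop k L, List.flatten_append]
    simp
  · intro h
    refine exists_flatten_eq_map_sum_eq β.blocks γ.blocks (fun x hx => γ.blocks_pos hx)
      (γ.blocks_sum.trans β.blocks_sum.symm) fun k => ?_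
    change ∃ m, β.sizeUpTo k = γ.sizeUpTo m
    have hle := β.sizeUpTo_le k
    by_cases h0 : β.sizeUpTo k = 0
    · exact ⟨0, by rw [h0, γ.sizeUpTo_zero]⟩
    by_cases hn : β.sizeUpTo k = n
    · exact ⟨γ.length, by rw [hn, γ.sizeUpTo_length]⟩
    have hi : (⟨β.sizeUpTo k - 1, by omega⟩ : Fin (n - 1)) ∈ toFinsetC β :=
      (mem_toFinsetC β _).2 ⟨k, by simp only; omega⟩
    obtain ⟨m, hm⟩ := (mem_toFinsetC γ _).1 (h hi)
    exact ⟨m, by simp only at hm; omega⟩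

theorem cellsOf_of_succ {l : List ℕ} {i j : ℕ} (h : (i, j + 1) ∈ cellsOf l) :
    (i, j) ∈ cellsOf l := by
  simp only [cellsOf, Finset.mem_filter, Finset.mem_product, Finset.mem_range] at h ⊢
  omega

theorem IsImm.apply_lt_of_std {n : ℕ} {l : List ℕ} {T : ℕ × ℕ → ℕ} (hI : IsImm l T)
    (hT : contentOf l T = stdContent n) {i j : ℕ} (h : (i, j + 1) ∈ cellsOf l) :
    T (i, j) < T (i, j + 1) := by
  refine lt_of_le_of_ne (hI.2.2.2 i j h) fun he => ?_
  have := entry_injOn_of_std hT (cellsOf_of_succ h) h he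
  simp at this

/-- Within a block of `γ`, the entries of a standard tableau with descents at the ends of blocks
of `γ` climb strictly. -/
theorem row_lt_of_blockOf_eq {n : ℕ} {l : List ℕ} {T : ℕ × ℕ → ℕ} {γ : Composition n}
    (hT : contentOf l T = stdContent n) (hD : DesRS n l T ⊆ toFinsetC γ) {c c' : ℕ × ℕ}
    (hc : c ∈ cellsOf l) (hc' : c' ∈ cellsOf l) (hlt : T c < T c')
    (hb : blockOf γ (T c) = blockOf γ (T c')) : c.1 < c'.1 := by
  obtain ⟨x, hx⟩ : ∃ x, T c' = x + 1 := ⟨T c' - 1, by omega⟩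
  induction x generalizing c' with
  | zero => have := entry_bounds_of_std hT hc; omega
  | succ x ih =>
    have hbd := entry_bounds_of_std hT hc
    have hbd' := entry_bounds_of_std hT hc'
    obtain ⟨e, he, hex⟩ := exists_entry_of_std hT (v := x + 1) (by omega) (by omega)
    have h1 := blockOf_mono γ (x := T c) (y := x + 1) (by omega) (by omega)
    have h2 := blockOf_mono γ (x := x + 1) (y := T c') (by omega) (by omega)
    have hstep : e.1 < c'.1 := by
      by_contra hcon
      have hmem : (⟨x, by omega⟩ : Fin (n - 1)) ∈ DesRS n l T := by
        simp only [DesRS, Finset.mem_filter, Finset.mem_univ, true_and]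
        exact ⟨e, he, c', hc', hex, hx, by omega⟩
      have := (blockOf_lt_succ_iff γ (x := x + 1) (by omega)).2
        ((mem_toFinsetC γ _).1 (hD hmem))
      rw [← hx] at this
      omega
    rcases (show T c ≤ x + 1 by omega).lt_or_eq with h | h
    · exact (ih he (by omega) (by rw [hex]; omega) hex).trans hstep
    · rwa [entry_injOn_of_std hT hc he (by omega)]

/-- The cells in the reading order in which a row-strict tableau is standardized: by entry, then
from bottom to top. -/
def readingKey (U : ℕ × ℕ → ℕ) (c : ℕ × ℕ) : ℕ ×ₗ ℕ := toLex (U c, c.1)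

theorem readingKey_lt_iff {U : ℕ × ℕ → ℕ} {c c' : ℕ × ℕ} :
    readingKey U c < readingKey U c' ↔ U c < U c' ∨ U c = U c' ∧ c.1 < c'.1 := by
  simp [readingKey, Prod.Lex.toLex_lt_toLex]

/-- Standardization of a filling. -/
noncomputable def standardize (l : List ℕ) (U : ℕ × ℕ → ℕ) (c : ℕ × ℕ) : ℕ :=
  if c ∈ cellsOf l then
    ((cellsOf l).filter fun c' => readingKey U c' ≤ readingKey U c).card
  else 0

section RowStrict

variable {l : List ℕ} {U : ℕ × ℕ → ℕ}

theorem IsRS.strictMono_row (hU : IsRS l U) {i j k : ℕ} (hjk : j < k)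
    (h : (i, k) ∈ cellsOf l) : U (i, j) < U (i, k) := by
  induction k, hjk using Nat.le_induction with
  | base => exact hU.2.2.2 i j h
  | succ k _ ih => exact (ih (cellsOf_of_succ h)).trans (hU.2.2.2 i k h)

theorem IsRS.readingKey_injOn (hU : IsRS l U) : Set.InjOn (readingKey U) (cellsOf l) := by
  rintro ⟨i, j⟩ hc ⟨i', j'⟩ hc' h
  obtain ⟨h1, rfl⟩ : U (i, j) = U (i', j') ∧ i = i' := by
    simpa [readingKey] using h
  rcases lt_trichotomy j j' with hj | rfl | hj
  · have := hU.strictMono_row hj hc'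
    omega
  · rfl
  · have := hU.strictMono_row hj hc
    omega

theorem standardize_lt {c c' : ℕ × ℕ} (hc : c ∈ cellsOf l) (hc' : c' ∈ cellsOf l)
    (h : readingKey U c < readingKey U c') : standardize l U c < standardize l U c' := by
  rw [standardize, standardize, if_pos hc, if_pos hc']
  refine Finset.card_lt_card (Finset.ssubset_iff_of_subset ?_ |>.2 ⟨c', ?_, ?_⟩)
  · exact Finset.monotone_filter_right _ fun e _ he => le_trans he h.le
  · exact Finset.mem_filter.2 ⟨hc', le_rfl⟩
  · exact fun hmem => (Finset.mem_filter.1 hmem).2.not_gt h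

theorem readingKey_lt_of_standardize_lt {c c' : ℕ × ℕ}
    (hc : c ∈ cellsOf l) (hc' : c' ∈ cellsOf l) (h : standardize l U c < standardize l U c') :
    readingKey U c < readingKey U c' := by
  by_contra hcon
  rcases (not_lt.1 hcon).lt_or_eq with h' | h'
  · exact (standardize_lt hc' hc h').not_gt h
  · simp [standardize, hc, hc', h'] at h

theorem IsRS.contentOf_standardize {n : ℕ} (hU : IsRS l U) (hcard : (cellsOf l).card = n) :
    contentOf l (standardize l U) = stdContent n := by
  refine contentOf_eq_stdContent_of_injOn hcard ?_ fun c hc => ?_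
  · intro c hc c' hc' h
    by_contra hne
    rcases lt_or_gt_of_ne (fun h' => hne (hU.readingKey_injOn hc hc' h')) with h' | h'
    · exact (standardize_lt hc hc' h').ne h
    · exact (standardize_lt hc' hc h').ne' h
  · rw [standardize, if_pos hc, ← hcard]
    exact ⟨Finset.card_pos.2 ⟨c, Finset.mem_filter.2 ⟨hc, le_rfl⟩⟩, Finset.card_filter_le _ _⟩

theorem IsRS.isImm_standardize (hU : IsRS l U) : IsImm l (standardize l U) := by
  refine ⟨fun c hc => ?_, fun c hc => if_neg hc, fun i i' hi hc hc' => ?_, fun i j hc => ?_⟩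
  · rw [standardize, if_pos hc]
    exact Finset.card_pos.2 ⟨c, Finset.mem_filter.2 ⟨hc, le_rfl⟩⟩
  · refine standardize_lt hc hc' (readingKey_lt_iff.2 ?_)
    have := hU.2.2.1 i i' hi hc hc'
    rcases this.lt_or_eq with h | h
    · exact Or.inl h
    · exact Or.inr ⟨h, hi⟩
  · exact (standardize_lt (cellsOf_of_succ hc) hc
      (readingKey_lt_iff.2 (Or.inl (hU.2.2.2 i j hc)))).le

end RowStrict

section Content

variable {n : ℕ} {γ : Composition n} {l : List ℕ} {T U : ℕ × ℕ → ℕ}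

theorem card_entries_le_of_compContent (hU : contentOf l U = compContent γ) (m : ℕ) :
    ((cellsOf l).filter fun c => U c ≤ m).card = γ.sizeUpTo m := by
  rw [card_entries_le_eq_sum_contentOf, hU, sum_range_compContent]

theorem card_cellsOf_of_compContent (hU : contentOf l U = compContent γ) :
    (cellsOf l).card = n := by
  have h := card_entries_le_of_compContent hU (max γ.length ((cellsOf l).sup U))
  rwa [γ.sizeUpTo_ofLength_le _ (le_max_left _ _), Finset.filter_true_of_mem] at h
  exact fun c hc => (Finset.le_sup hc).trans (le_max_right _ _)

theorem blockOf_standardize (hR : IsRS l U) (hU : contentOf l U = compContent γ) :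
    (fun c => blockOf γ (standardize l U c)) = U := by
  funext c
  by_cases hc : c ∈ cellsOf l
  · have hT := hR.contentOf_standardize (card_cellsOf_of_compContent hU)
    have hle := (entry_bounds_of_std hT hc).2
    have h1 := hR.1 c hc
    refine le_antisymm ((blockOf_le_iff γ hle _).2 ?_) ?_
    · rw [← card_entries_le_of_compContent hU, standardize, if_pos hc]
      refine Finset.card_le_card (Finset.monotone_filter_right _ fun e _ he => ?_)
      exact Prod.Lex.monotone_fst _ _ he
    · by_contra hlt
      have h2 := (blockOf_le_iff γ hle (U c - 1)).1 (by omega)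
      rw [← card_entries_le_of_compContent hU, standardize, if_pos hc] at h2
      refine h2.not_gt (Finset.card_lt_card
        (Finset.ssubset_iff_of_subset ?_ |>.2 ⟨c, ?_, ?_⟩))
      · refine Finset.monotone_filter_right _ fun e _ he => ?_
        exact (readingKey_lt_iff.2 (Or.inl (show U e < U c by omega))).le
      · exact Finset.mem_filter.2 ⟨hc, le_rfl⟩
      · intro hmem
        have := (Finset.mem_filter.1 hmem).2
        omega
  · simp [standardize, hc, blockOf_zero, hR.2.1 c hc]

theorem DesRS_standardize_subset (hR : IsRS l U) (hU : contentOf l U = compContent γ) :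
    DesRS n l (standardize l U) ⊆ toFinsetC γ := by
  intro i hi
  simp only [DesRS, Finset.mem_filter, Finset.mem_univ, true_and] at hi
  obtain ⟨c, hc, c', hc', h, h', hrow⟩ := hi
  rw [mem_toFinsetC, ← blockOf_lt_succ_iff γ (by have := i.isLt; omega)]
  have hkey := readingKey_lt_of_standardize_lt (U := U) hc hc' (by omega)
  have hbc := congrFun (blockOf_standardize hR hU) c
  have hbc' := congrFun (blockOf_standardize hR hU) c'
  simp only [h, h'] at hbc hbc'
  rw [readingKey_lt_iff] at hkey
  rw [hbc, Nat.add_assoc, hbc']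
  omega

theorem isRS_blockOf (hI : IsImm l T) (hT : contentOf l T = stdContent n)
    (hD : DesRS n l T ⊆ toFinsetC γ) : IsRS l fun c => blockOf γ (T c) := by
  refine ⟨fun c hc => ?_, fun c hc => ?_, fun i i' hi hc hc' => ?_, fun i j hc => ?_⟩
  · have := entry_bounds_of_std hT hc
    exact one_le_blockOf γ this.1 this.2
  · simp only [hI.2.1 c hc, blockOf_zero]
  · exact blockOf_mono γ (hI.2.2.1 i i' hi hc hc').le (entry_bounds_of_std hT hc').2
  · have hlt := hI.apply_lt_of_std hT hc
    refine lt_of_le_of_ne (blockOf_mono γ hlt.le (entry_bounds_of_std hT hc).2) fun h => ?_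
    exact (row_lt_of_blockOf_eq hT hD (cellsOf_of_succ hc) hc hlt h).false

theorem contentOf_blockOf (hT : contentOf l T = stdContent n) :
    contentOf l (fun c => blockOf γ (T c)) = compContent γ := by
  rw [contentOf_eq_iff_card_entries_le]
  intro m
  rw [sum_range_compContent, ← min_eq_left (γ.sizeUpTo_le m), ← card_entries_le_of_std hT]
  congr 1
  exact Finset.filter_congr fun c hc => blockOf_le_iff γ (entry_bounds_of_std hT hc).2 m

theorem standardize_blockOf (hI : IsImm l T) (hT : contentOf l T = stdContent n)
    (hD : DesRS n l T ⊆ toFinsetC γ) : standardize l (fun c => blockOf γ (T c)) = T := by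
  have hlt : ∀ c ∈ cellsOf l, ∀ c' ∈ cellsOf l, T c < T c' →
      readingKey (fun c => blockOf γ (T c)) c < readingKey (fun c => blockOf γ (T c)) c' := by
    intro c hc c' hc' h
    rw [readingKey_lt_iff]
    rcases (blockOf_mono γ h.le (entry_bounds_of_std hT hc').2).lt_or_eq with hb | hb
    · exact Or.inl hb
    · exact Or.inr ⟨hb, row_lt_of_blockOf_eq hT hD hc hc' h hb⟩
  funext c
  by_cases hc : c ∈ cellsOf l
  · rw [standardize, if_pos hc]
    conv_rhs => rw [← min_eq_left (entry_bounds_of_std hT hc).2, ← card_entries_le_of_std hT]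
    congr 1
    refine Finset.filter_congr fun e he => ⟨fun h => ?_, fun h => ?_⟩
    · by_contra hcon
      exact (hlt c hc e he (not_le.1 hcon)).not_ge h
    · rcases h.lt_or_eq with h' | h'
      · exact (hlt e he c hc h').le
      · rw [entry_injOn_of_std hT he hc h']
  · rw [standardize, if_neg hc, hI.2.1 c hc]

end Content

/-- Row-strict tableaux of content `γ` correspond, by standardization, to standard tableaux with
descent composition coarsening `γ`. -/
noncomputable def rowStrictEquiv {n : ℕ} (α γ : Composition n) :
    {U : ℕ × ℕ → ℕ // IsRS α.blocks U ∧ contentOf α.blocks U = compContent γ} ≃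
      {T : ℕ × ℕ → ℕ // (IsImm α.blocks T ∧ contentOf α.blocks T = stdContent n) ∧
        DesRS n α.blocks T ⊆ toFinsetC γ} where
  toFun U := ⟨standardize α.blocks U, ⟨U.2.1.isImm_standardize,
    U.2.1.contentOf_standardize (card_cellsOf_of_compContent U.2.2)⟩,
    DesRS_standardize_subset U.2.1 U.2.2⟩
  invFun T := ⟨fun c => blockOf γ (T.1 c), isRS_blockOf T.2.1.1 T.2.1.2 T.2.2,
    contentOf_blockOf T.2.1.2⟩
  left_inv U := Subtype.ext (blockOf_standardize U.2.1 U.2.2)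
  right_inv T := Subtype.ext (standardize_blockOf T.2.1.1 T.2.1.2 T.2.2)

theorem finite_standard (n : ℕ) (l : List ℕ) :
    Finite {T : ℕ × ℕ → ℕ // IsImm l T ∧ contentOf l T = stdContent n} := by
  refine Finite.of_injective (β := cellsOf l → Fin (n + 1))
    (fun T c => ⟨T.1 c, Nat.lt_succ_of_le (entry_bounds_of_std T.2.2 c.2).2⟩) ?_
  intro T T' h
  refine Subtype.ext (funext fun c => ?_)
  by_cases hc : c ∈ cellsOf l
  · simpa using congrFun h ⟨c, hc⟩
  · rw [T.2.1.2.1 c hc, T'.2.1.2.1 c hc]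

/-- Counting a type by the fibres of a map over the values satisfying `p`. -/
theorem sum_card_fiber_eq_card {X ι : Type*} [Finite X] [Fintype ι] (f : X → ι) (p : ι → Prop) :
    ∑ b ∈ Finset.univ.filter p, Nat.card {x // f x = b} = Nat.card {x // p (f x)} := by
  have := Fintype.ofFinite X
  simp only [Nat.card_eq_fintype_card, Fintype.card_subtype]
  rw [Finset.card_eq_sum_card_fiberwise (f := f) (t := Finset.univ.filter p)]
  · refine Finset.sum_congr rfl fun b hb => ?_
    rw [Finset.filter_filter]
    congr 1
    ext x
    simp only [Finset.mem_filter, Finset.mem_univ, true_and] at hb ⊢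
    exact ⟨fun h => ⟨h ▸ hb, h⟩, fun h => h.2⟩
  · intro x hx
    simpa using hx

/-- The two descent sets of a standard tableau are complementary. -/
theorem DesDI_eq_compl {n : ℕ} {l : List ℕ} {T : ℕ × ℕ → ℕ}
    (hT : contentOf l T = stdContent n) : DesDI n l T = (DesRS n l T)ᶜ := by
  ext i
  have hi := i.isLt
  obtain ⟨c, hc, hci⟩ := exists_entry_of_std hT (v := i.val + 1) (by omega) (by omega)
  obtain ⟨c', hc', hci'⟩ := exists_entry_of_std hT (v := i.val + 2) (by omega) (by omega)
  simp only [DesDI, DesRS, Finset.mem_compl, Finset.mem_filter, Finset.mem_univ, true_and]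
  constructor
  · rintro ⟨d, hd, d', hd', h, h', hlt⟩ ⟨e, he, e', he', g, g', hle⟩
    obtain rfl := entry_injOn_of_std hT hd he (h.trans g.symm)
    obtain rfl := entry_injOn_of_std hT hd' he' (h'.trans g'.symm)
    omega
  · intro h
    exact ⟨c, hc, c', hc', hci, hci', not_le.1 fun hle => h ⟨c, hc, c', hc', hci, hci', hle⟩⟩

theorem Lstar_eq_Lnum_complC {n : ℕ} (α β : Composition n) : Lstar α β = Lnum α (complC β) := by
  refine Nat.card_congr (Equiv.subtypeEquivRight fun T => ?_)
  refine and_congr_right fun _ => and_congr_right fun hT => ?_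
  rw [descCompRS, descCompDI, ofFinsetC_eq_iff, ofFinsetC_eq_iff, complC, toFinsetC_ofFinsetC,
    DesDI_eq_compl hT, compl_inj_iff]

theorem Kstar_eq_sum_Lstar_refines {n : ℕ} (α γ : Composition n) :
    Kstar α γ =
      ∑ β ∈ Finset.univ.filter (fun β : Composition n => Refines γ β), Lstar α β := by
  have := finite_standard n α.blocks
  have hL : ∀ β, Lstar α β = Nat.card {T : {T : ℕ × ℕ → ℕ //
      IsImm α.blocks T ∧ contentOf α.blocks T = stdContent n} // descCompRS α T.1 = β} := fun β =>
    Nat.card_congr ((Equiv.subtypeEquivRight fun T => and_assoc.symm).trans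
      (Equiv.subtypeSubtypeEquivSubtypeInter _ fun T => descCompRS α T = β).symm)
  simp only [hL]
  rw [sum_card_fiber_eq_card (fun T : {T : ℕ × ℕ → ℕ //
      IsImm α.blocks T ∧ contentOf α.blocks T = stdContent n} => descCompRS α T.1) (Refines γ)]
  refine Nat.card_congr ((rowStrictEquiv α γ).trans ((Equiv.subtypeEquivRight fun T => ?_).trans
    (Equiv.subtypeSubtypeEquivSubtypeInter _ fun T => Refines γ (descCompRS α T)).symm))
  rw [refines_iff, descCompRS, toFinsetC_ofFinsetC]

/-- For `γ ≤_ℓ α`: `K*_{α,γ} = ∑_{β ≽ γ} L*_{α,β} = ∑_{β ≽ γ} L_{α,βᶜ}`. -/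
theorem Kstar_eq_sum_Lstar (n : ℕ) (α γ : Composition n) (hlex : lexLE γ α) :
    (Kstar α γ = ∑ β ∈ Finset.univ.filter (fun β : Composition n => Refines γ β), Lstar α β) ∧
    (Kstar α γ =
      ∑ β ∈ Finset.univ.filter (fun β : Composition n => Refines γ β), Lnum α (complC β)) := by
  have h := Kstar_eq_sum_Lstar_refines α γ
  exact ⟨h, h.trans (Finset.sum_congr rfl fun β _ => Lstar_eq_Lnum_complC α β)⟩
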